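/- The function V_{2,H} is continuously differentiable on (0,+∞) and its derivative satisfies lim_{t→+∞} e^{t/θ} t^{2−2H} V'_{2,H}(t) = 2H(2H−1)θ. -/

import Mathlib

open MeasureTheory Set Filter
open scoped Topology

/-- The primitive `∫₀ˣ e^{sw} w^a dw` of an exponential times a power. -/
noncomputable def expRpowPrimitive (a s x : ℝ) : ℝ :=
  ∫ w in (0:ℝ)..x, Real.exp (s * w) * w ^ a

lemma intervalIntegrable_exp_mul_rpow {a : ℝ} (ha : -1 < a) (s x y : ℝ) :
    IntervalIntegrable (fun w : ℝ => Real.exp (s * w) * w ^ a) volume x y :=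
  (intervalIntegral.intervalIntegrable_rpow' ha).continuousOn_mul (by fun_prop)

lemma continuous_expRpowPrimitive {a : ℝ} (ha : -1 < a) (s : ℝ) :
    Continuous (expRpowPrimitive a s) :=
  intervalIntegral.continuous_primitive (fun _ _ => intervalIntegrable_exp_mul_rpow ha s _ _) 0

@[simp]
lemma expRpowPrimitive_zero (a s : ℝ) : expRpowPrimitive a s 0 = 0 := by
  simp [expRpowPrimitive]

lemma hasDerivAt_expRpowPrimitive {a : ℝ} (ha : -1 < a) (s : ℝ) {x : ℝ} (hx : 0 < x) :
    HasDerivAt (expRpowPrimitive a s) (Real.exp (s * x) * x ^ a) x := by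
  refine intervalIntegral.integral_hasDerivAt_right (intervalIntegrable_exp_mul_rpow ha s _ _)
    (Measurable.stronglyMeasurable (by fun_prop)).stronglyMeasurableAtFilter ?_
  have := Real.continuousAt_rpow_const x a (Or.inl hx.ne')
  fun_prop

/-- Integration by parts of the primitive against the reflected exponential. -/
lemma integral_exp_mul_expRpowPrimitive {a : ℝ} (ha : -1 < a) {s : ℝ} (hs : s ≠ 0) {t : ℝ}
    (ht : 0 ≤ t) :
    ∫ u in (0:ℝ)..t, Real.exp (-2 * s * u) * expRpowPrimitive a s u =
      -(1 / (2 * s)) *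
        (Real.exp (-2 * s * t) * expRpowPrimitive a s t - expRpowPrimitive a (-s) t) := by
  have hc := continuous_expRpowPrimitive ha s
  have hc' := continuous_expRpowPrimitive ha (-s)
  rw [intervalIntegral.integral_eq_sub_of_hasDerivAt_of_le ht
    (f := fun u => -(1 / (2 * s)) *
      (Real.exp (-2 * s * u) * expRpowPrimitive a s u - expRpowPrimitive a (-s) u))]
  · simp
  · fun_prop
  · intro x hx
    have h₁ : HasDerivAt (fun u : ℝ => Real.exp (-2 * s * u))
        (Real.exp (-2 * s * x) * (-2 * s)) x := by
      simpa using ((hasDerivAt_id x).const_mul (-2 * s)).exp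
    convert! ((h₁.mul (hasDerivAt_expRpowPrimitive ha s hx.1)).sub
      (hasDerivAt_expRpowPrimitive ha (-s) hx.1)).const_mul (-(1 / (2 * s))) using 1
    have : Real.exp (-s * x) = Real.exp (-2 * s * x) * Real.exp (s * x) := by
      rw [← Real.exp_add]; ring_nf
    rw [this]
    field_simp
    ring
  · exact Continuous.intervalIntegrable (by fun_prop) _ _

lemma integral_exp_mul_abs_sub_rpow {a : ℝ} (ha : -1 < a) (s : ℝ) {t u : ℝ}
    (hu : u ∈ Icc 0 t) :
    ∫ v in (0:ℝ)..t, Real.exp (s * (u + v)) * |u - v| ^ a =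
      Real.exp (2 * s * u) * (expRpowPrimitive a (-s) u + expRpowPrimitive a s (t - u)) := by
  set f : ℝ → ℝ := fun v => Real.exp (s * (u + v)) * |u - v| ^ a
  set g : ℝ → ℝ := fun w => Real.exp (2 * s * u) * (Real.exp (-s * w) * w ^ a)
  set h : ℝ → ℝ := fun w => Real.exp (2 * s * u) * (Real.exp (s * w) * w ^ a)
  have hfg : EqOn f (fun v => g (u - v)) (uIcc 0 u) := by
    intro v hv
    rw [uIcc_of_le hu.1] at hv
    simp only [f, g]
    rw [abs_of_nonneg (sub_nonneg.2 hv.2), ← mul_assoc, ← Real.exp_add]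
    ring_nf
  have hfh : EqOn f (fun v => h (v - u)) (uIcc u t) := by
    intro v hv
    rw [uIcc_of_le hu.2] at hv
    simp only [f, h]
    rw [abs_sub_comm, abs_of_nonneg (sub_nonneg.2 hv.1), ← mul_assoc, ← Real.exp_add]
    ring_nf
  have hg : IntervalIntegrable (fun v => g (u - v)) volume 0 u := by
    simpa [g] using (((intervalIntegrable_exp_mul_rpow ha (-s) 0 u).const_mul
      (Real.exp (2 * s * u))).comp_sub_left u).symm
  have hh : IntervalIntegrable (fun v => h (v - u)) volume u t := by
    simpa using ((intervalIntegrable_exp_mul_rpow ha s 0 (t - u)).const_mul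
      (Real.exp (2 * s * u))).comp_sub_right u
  rw [← intervalIntegral.integral_add_adjacent_intervals
    (hg.congr_uIoo (hfg.symm.mono uIoo_subset_uIcc_self))
    (hh.congr_uIoo (hfh.symm.mono uIoo_subset_uIcc_self)),
    intervalIntegral.integral_congr hfg, intervalIntegral.integral_congr hfh,
    intervalIntegral.integral_comp_sub_left g, intervalIntegral.integral_comp_sub_right h]
  simp [g, h, expRpowPrimitive, mul_add]

lemma integral_integral_exp_mul_abs_sub_rpow {a : ℝ} (ha : -1 < a) {s : ℝ} (hs : s ≠ 0) {t : ℝ}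
    (ht : 0 ≤ t) :
    ∫ u in (0:ℝ)..t, ∫ v in (0:ℝ)..t, Real.exp (s * (u + v)) * |u - v| ^ a =
      1 / s * (Real.exp (2 * s * t) * expRpowPrimitive a (-s) t - expRpowPrimitive a s t) := by
  have hc := continuous_expRpowPrimitive ha s
  have hc' := continuous_expRpowPrimitive ha (-s)
  have hsplit : EqOn (fun u => ∫ v in (0:ℝ)..t, Real.exp (s * (u + v)) * |u - v| ^ a)
      (fun u => Real.exp (-2 * -s * u) * expRpowPrimitive a (-s) u +
        Real.exp (2 * s * t) *
          (Real.exp (-2 * s * (t - u)) * expRpowPrimitive a s (t - u))) (uIcc 0 t) := by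
    intro u hu
    rw [uIcc_of_le ht] at hu
    simp only
    rw [integral_exp_mul_abs_sub_rpow ha s hu, ← mul_assoc (Real.exp (2 * s * t)),
      ← Real.exp_add, mul_add]
    ring_nf
  rw [intervalIntegral.integral_congr hsplit, intervalIntegral.integral_add
    (Continuous.intervalIntegrable (by fun_prop) _ _)
    (Continuous.intervalIntegrable (by fun_prop) _ _), intervalIntegral.integral_const_mul,
    intervalIntegral.integral_comp_sub_left
      (fun w => Real.exp (-2 * s * w) * expRpowPrimitive a s w), sub_self, sub_zero,
    integral_exp_mul_expRpowPrimitive ha (neg_ne_zero.2 hs) ht,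
    integral_exp_mul_expRpowPrimitive ha hs ht, neg_neg]
  have h₁ : Real.exp (-2 * -s * t) = Real.exp (2 * s * t) := by ring_nf
  have h₂ : Real.exp (2 * s * t) * Real.exp (-2 * s * t) = 1 := by
    rw [← Real.exp_add]; ring_nf; simp
  rw [h₁]
  generalize Real.exp (-2 * s * t) = x at h₂ ⊢
  field_simp
  linear_combination -expRpowPrimitive a s t * h₂

lemma mul_le_expRpowPrimitive {a : ℝ} (ha : -1 < a) (ha' : a ≤ 0) {s : ℝ} (hs : s ≠ 0) {t : ℝ}
    (ht : 0 ≤ t) :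
    t ^ a * ((Real.exp (s * t) - 1) / s) ≤ expRpowPrimitive a s t := by
  have h : ∫ w in (0:ℝ)..t, Real.exp (s * w) * t ^ a = t ^ a * ((Real.exp (s * t) - 1) / s) := by
    rw [intervalIntegral.integral_mul_const, intervalIntegral.integral_comp_mul_left _ hs]
    simp
    ring
  rw [← h]
  refine intervalIntegral.integral_mono_on_of_le_Ioo ht
    (Continuous.intervalIntegrable (by fun_prop) _ _) (intervalIntegrable_exp_mul_rpow ha s _ _) ?_
  intro w hw
  exact mul_le_mul_of_nonneg_left (Real.rpow_le_rpow_of_nonpos hw.1 hw.2.le ha')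
    (Real.exp_pos _).le

/-- An upper bound to second order, obtained by comparing derivatives. -/
lemma exists_expRpowPrimitive_le {a : ℝ} (ha : -1 < a) {s : ℝ} (hs : s ≠ 0) :
    ∃ M C : ℝ, ∀ᶠ t in atTop, expRpowPrimitive a s t ≤
      Real.exp (s * t) * (1 / s * t ^ a + M * t ^ (a - 1)) + C := by
  set M := (1 - a / s) / s with hM
  set T := max 1 (M * (1 - a))
  have hT : 0 < T := lt_max_of_lt_left one_pos
  set φ : ℝ → ℝ := fun t => Real.exp (s * t) * (1 / s * t ^ a + M * t ^ (a - 1)) -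
    expRpowPrimitive a s t
  have hφ : ∀ t, 0 < t → HasDerivAt φ (Real.exp (s * t) * t ^ (a - 2) * (t - M * (1 - a))) t := by
    intro t ht
    have h₁ : HasDerivAt (fun u : ℝ => Real.exp (s * u)) (Real.exp (s * t) * s) t := by
      simpa using ((hasDerivAt_id t).const_mul s).exp
    have h₂ := Real.hasDerivAt_rpow_const (p := a) (Or.inl ht.ne')
    have h₃ := Real.hasDerivAt_rpow_const (p := a - 1) (Or.inl ht.ne')
    convert! (h₁.mul ((h₂.const_mul (1 / s)).add (h₃.const_mul M))).sub
      (hasDerivAt_expRpowPrimitive ha s ht) using 1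
    have e₁ : t ^ (a - 1) = t ^ (a - 2) * t := by
      rw [← Real.rpow_add_one ht.ne']; ring_nf
    have e₂ : t ^ (a - 1 - 1) = t ^ (a - 2) := by ring_nf
    have e₃ : s * M = 1 - a / s := by rw [hM]; field_simp
    have e₄ : s * (1 / s) = 1 := by field_simp
    simp only [Pi.add_apply]
    rw [e₂, e₁]
    linear_combination (-Real.exp (s * t) * t ^ (a - 2) * t) * e₃ -
      Real.exp (s * t) * t ^ a * e₄
  have hmono : MonotoneOn φ (Ici T) := by
    refine monotoneOn_of_deriv_nonneg (convex_Ici T)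
      (fun t ht => (hφ t (hT.trans_le ht)).continuousAt.continuousWithinAt) ?_ ?_
    · rw [interior_Ici]
      exact fun t ht => (hφ t (hT.trans ht)).differentiableAt.differentiableWithinAt
    · rw [interior_Ici]
      intro t ht
      have ht₀ := hT.trans ht
      have : M * (1 - a) ≤ t := (le_max_right _ _).trans (le_of_lt ht)
      rw [(hφ t ht₀).deriv]
      have := sub_nonneg.2 this
      positivity
  refine ⟨M, -φ T, ?_⟩
  filter_upwards [eventually_ge_atTop T] with t ht
  have := hmono self_mem_Ici ht ht
  simp only [φ] at this ⊢
  linarith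

lemma tendsto_exp_mul_expRpowPrimitive {a : ℝ} (ha : -1 < a) (ha' : a ≤ 0) {s : ℝ} (hs : 0 < s) :
    Tendsto (fun t => Real.exp (-s * t) * t ^ (-a) * expRpowPrimitive a s t) atTop
      (𝓝 (1 / s)) := by
  obtain ⟨M, C, hMC⟩ := exists_expRpowPrimitive_le ha hs.ne'
  have hexp : Tendsto (fun t : ℝ => Real.exp (-s * t)) atTop (𝓝 0) := by
    simpa using tendsto_rpow_mul_exp_neg_mul_atTop_nhds_zero 0 s hs
  have hlow : Tendsto (fun t : ℝ => (1 - Real.exp (-s * t)) / s) atTop (𝓝 (1 / s)) := by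
    simpa using (hexp.const_sub 1).div_const s
  have hup : Tendsto (fun t : ℝ => 1 / s + M * t⁻¹ + C * (t ^ (-a) * Real.exp (-s * t))) atTop
      (𝓝 (1 / s)) := by
    simpa using (tendsto_const_nhds.add (tendsto_inv_atTop_zero.const_mul M)).add
      ((tendsto_rpow_mul_exp_neg_mul_atTop_nhds_zero (-a) s hs).const_mul C)
  have hinv (t : ℝ) : Real.exp (-s * t) * Real.exp (s * t) = 1 := by
    rw [← Real.exp_add]; simp
  refine tendsto_of_tendsto_of_tendsto_of_le_of_le' hlow hup ?_ ?_
  · filter_upwards [eventually_gt_atTop 0] with t ht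
    have e : t ^ (-a) * t ^ a = 1 := by rw [← Real.rpow_add ht]; simp
    calc (1 - Real.exp (-s * t)) / s
        = Real.exp (-s * t) * t ^ (-a) * (t ^ a * ((Real.exp (s * t) - 1) / s)) := by
          linear_combination (-(t ^ (-a) * t ^ a) / s) * hinv t -
            (1 - Real.exp (-s * t)) / s * e
      _ ≤ _ := by gcongr; exact mul_le_expRpowPrimitive ha ha' hs.ne' ht.le
  · filter_upwards [eventually_gt_atTop 0, hMC] with t ht hle
    have e : t ^ (-a) * t ^ a = 1 := by rw [← Real.rpow_add ht]; simp
    calc _ ≤ Real.exp (-s * t) * t ^ (-a) *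
          (Real.exp (s * t) * (1 / s * t ^ a + M * t ^ (a - 1)) + C) := by gcongr
      _ = _ := by
          rw [Real.rpow_sub_one ht.ne']
          linear_combination (t ^ (-a) * t ^ a) * (1 / s + M * t⁻¹) * hinv t +
            (1 / s + M * t⁻¹) * e

/-- The variance `V_{2,H}` of the fractional Ornstein–Uhlenbeck process is continuously
differentiable on `(0,∞)` and `lim_{t→+∞} e^{t/θ} t^{2−2H} V'_{2,H}(t) = 2H(2H−1)θ`. -/
theorem stmt_4 (H θ : ℝ) (hH : H ∈ Set.Ioo (1/2 : ℝ) 1) (hθ : 0 < θ)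
    (V : ℝ → ℝ)
    (hV : ∀ t : ℝ, V t = H * (2*H - 1) * Real.exp (-2*t/θ) *
      ∫ u in (0:ℝ)..t, ∫ v in (0:ℝ)..t, Real.exp ((u+v)/θ) * |u - v| ^ (2*H - 2)) :
    (∀ t ∈ Set.Ioi (0:ℝ), DifferentiableAt ℝ V t) ∧
    ContinuousOn (deriv V) (Set.Ioi 0) ∧
    Tendsto (fun t => Real.exp (t/θ) * t ^ (2 - 2*H) * deriv V t) atTop
      (𝓝 (2*H*(2*H - 1)*θ)) := by
  obtain ⟨hH₁, hH₂⟩ := hH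
  set a := 2 * H - 2 with ha_def
  have ha : -1 < a := by linarith
  have ha' : a ≤ 0 := by linarith
  set s := 1 / θ with hs_def
  have hs : 0 < s := by positivity
  have hV' : EqOn V (fun t => H * (2 * H - 1) * (1 / s * (expRpowPrimitive a (-s) t -
      Real.exp (-2 * s * t) * expRpowPrimitive a s t))) (Ici 0) := by
    intro t ht
    have h₁ (u v : ℝ) : Real.exp ((u + v) / θ) = Real.exp (s * (u + v)) := by
      rw [hs_def]; ring_nf
    have h₂ : -2 * t / θ = -2 * s * t := by rw [hs_def]; ring
    have h₃ : Real.exp (-2 * s * t) * Real.exp (2 * s * t) = 1 := by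
      rw [← Real.exp_add]; ring_nf; simp
    simp only [hV, h₁, h₂]
    rw [integral_integral_exp_mul_abs_sub_rpow ha hs.ne' ht]
    linear_combination (H * (2 * H - 1) * (1 / s) * expRpowPrimitive a (-s) t) * h₃
  have hderiv : ∀ t ∈ Ioi (0:ℝ), HasDerivAt V
      (2 * (H * (2 * H - 1)) * (Real.exp (-2 * s * t) * expRpowPrimitive a s t)) t := by
    intro t ht
    have h₁ : HasDerivAt (fun u : ℝ => Real.exp (-2 * s * u))
        (Real.exp (-2 * s * t) * (-2 * s)) t := by
      simpa using ((hasDerivAt_id t).const_mul (-2 * s)).exp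
    have h := (((hasDerivAt_expRpowPrimitive ha (-s) ht).sub
      (h₁.mul (hasDerivAt_expRpowPrimitive ha s ht))).const_mul (1 / s)).const_mul
        (H * (2 * H - 1))
    refine HasDerivAt.congr_of_eventuallyEq ?_ (hV'.eventuallyEq_of_mem (Ici_mem_nhds ht))
    convert! h using 1
    have : Real.exp (-s * t) = Real.exp (-2 * s * t) * Real.exp (s * t) := by
      rw [← Real.exp_add]; ring_nf
    rw [this]
    field_simp
    ring
  refine ⟨fun t ht => (hderiv t ht).differentiableAt, ?_, ?_⟩
  · have hc := continuous_expRpowPrimitive ha s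
    refine ContinuousOn.congr (Continuous.continuousOn ?_) fun t ht => (hderiv t ht).deriv
    fun_prop
  · have hlim := (tendsto_exp_mul_expRpowPrimitive ha ha' hs).const_mul (2 * (H * (2 * H - 1)))
    have hval : 2 * (H * (2 * H - 1)) * (1 / s) = 2 * H * (2 * H - 1) * θ := by
      rw [hs_def]; field_simp
    rw [hval] at hlim
    refine hlim.congr' ?_
    filter_upwards [eventually_gt_atTop 0] with t ht
    have h₁ : Real.exp (-s * t) = Real.exp (t / θ) * Real.exp (-2 * s * t) := by
      rw [← Real.exp_add, hs_def]; ring_nf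
    have h₂ : -a = 2 - 2 * H := by rw [ha_def]; ring
    rw [(hderiv t ht).deriv, h₁, h₂]
    ring
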